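/- Let 𝕏 be a countable homogeneous relational structure, and suppose there exist f, g ∈ End(𝕏) such that f is back and fo and g is rth. Then End(𝕏), equipped with the pointwise topology, has property X with respect to Aut(𝕏). -/

import Mathlib

open Set

variable {A : Type*} {ι : Type*}

/-- `f` is a homomorphism (endomorphism) of the relational structure `(A, rel)`. -/
def IsHom (ar : ι → ℕ) (rel : ∀ i, (Fin (ar i) → A) → Prop) (f : A → A) : Prop :=
  ∀ (i : ι) (x : Fin (ar i) → A), rel i x → rel i (f ∘ x)

/-- `f` is a self-embedding of the relational structure `(A, rel)`. -/
def IsEmb (ar : ι → ℕ) (rel : ∀ i, (Fin (ar i) → A) → Prop) (f : A → A) : Prop :=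
  Function.Injective f ∧ ∀ (i : ι) (x : Fin (ar i) → A), (rel i x ↔ rel i (f ∘ x))

/-- `f` is an automorphism of the relational structure `(A, rel)`. -/
def IsAuto (ar : ι → ℕ) (rel : ∀ i, (Fin (ar i) → A) → Prop) (f : A → A) : Prop :=
  Function.Bijective f ∧ ∀ (i : ι) (x : Fin (ar i) → A), (rel i x ↔ rel i (f ∘ x))

/-- `p` is an isomorphism between induced substructures when restricted to `D`. -/
def IsPartialIsoOn (ar : ι → ℕ) (rel : ∀ i, (Fin (ar i) → A) → Prop)
    (D : Set A) (p : A → A) : Prop :=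
  Set.InjOn p D ∧
    ∀ (i : ι) (x : Fin (ar i) → A), (∀ k, x k ∈ D) → (rel i x ↔ rel i (p ∘ x))

/-- `p` is a homomorphism between induced substructures when restricted to `D`. -/
def IsPartialHomOn (ar : ι → ℕ) (rel : ∀ i, (Fin (ar i) → A) → Prop)
    (D : Set A) (p : A → A) : Prop :=
  ∀ (i : ι) (x : Fin (ar i) → A), (∀ k, x k ∈ D) → rel i x → rel i (p ∘ x)

/-- Every isomorphism between finite induced substructures extends to an automorphism. -/
def Homogeneous (ar : ι → ℕ) (rel : ∀ i, (Fin (ar i) → A) → Prop) : Prop :=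
  ∀ (D : Finset A) (p : A → A), IsPartialIsoOn ar rel ↑D p →
    ∃ g : A → A, IsAuto ar rel g ∧ ∀ a ∈ D, g a = p a

/-- Every orbit on `A \ F` of the pointwise stabiliser of a finite set `F` is infinite. -/
def NoAlgebraicity (ar : ι → ℕ) (rel : ∀ i, (Fin (ar i) → A) → Prop) : Prop :=
  ∀ (F : Finset A) (a : A), a ∉ F →
    {b : A | ∃ g : A → A, IsAuto ar rel g ∧ (∀ x ∈ F, g x = x) ∧ g a = b}.Infinite

/-- For every `k`, the action of the automorphism group on `k`-tuples has
finitely many orbits. -/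
def OmegaCategorical (ar : ι → ℕ) (rel : ∀ i, (Fin (ar i) → A) → Prop) : Prop :=
  ∀ k : ℕ,
    (Set.range fun v : Fin k → A =>
      {w : Fin k → A | ∃ g : A → A, IsAuto ar rel g ∧ w = g ∘ v}).Finite

/-- The endomorphisms of `(A, rel)`, as a set of functions. -/
def endSet (ar : ι → ℕ) (rel : ∀ i, (Fin (ar i) → A) → Prop) : Set (A → A) :=
  {f : A → A | IsHom ar rel f}

/-- The self-embeddings of `(A, rel)`, as a set of functions. -/
def embSet (ar : ι → ℕ) (rel : ∀ i, (Fin (ar i) → A) → Prop) : Set (A → A) :=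
  {f : A → A | IsEmb ar rel f}

/-- The automorphisms of `(A, rel)`, as a set of functions. -/
def autSet (ar : ι → ℕ) (rel : ∀ i, (Fin (ar i) → A) → Prop) : Set (A → A) :=
  {f : A → A | IsAuto ar rel f}

/-- `(A, rel)` is arsfacere, witnessed by the relation symbol `E`. -/
def ArsfacereWith (ar : ι → ℕ) (rel : ∀ i, (Fin (ar i) → A) → Prop) (E : ι) : Prop :=
  (∀ x : A, ¬ rel E (fun _ => x)) ∧
  ∀ (x : A) (F : Fin (ar E) → Finset A),
    (∀ i j : Fin (ar E), i ≠ j → ((F i : Set A) ∩ (F j : Set A)) = {x}) →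
    ∃ f : A → A,
      Set.InjOn f (⋃ i, (F i : Set A)) ∧
      (∀ i, IsPartialIsoOn ar rel (F i : Set A) f) ∧
      ∀ y : Fin (ar E) → A, (∀ k, y k ∈ F k ∧ y k ≠ x) →
        ∃ σ : Equiv.Perm (Fin (ar E)), rel E (fun k => f (y (σ k)))

open Classical in
/-- The endomorphism `g` is **rth**: it is surjective, and whenever the
extension of `g|_U` by `u ↦ v` (for `u ∉ U` finite) is a homomorphism between
induced substructures, there is an automorphism fixing `U` pointwise taking
`u` to a `g`-preimage of `v`. -/
def IsRth (ar : ι → ℕ) (rel : ∀ i, (Fin (ar i) → A) → Prop) (g : A → A) : Prop :=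
  Function.Surjective g ∧
    ∀ (U : Finset A) (u : A), u ∉ U → ∀ v : A,
      IsPartialHomOn ar rel (↑U ∪ {u}) (fun x => if _h : x = u then v else g x) →
      ∃ α : A → A, IsAuto ar rel α ∧ (∀ x ∈ U, α x = x) ∧ g (α u) = v

/-- The endomorphism `f` is **fo**: it is a self-embedding, and for every
finite `Y ⊆ A ∖ im(f)` there is a finite `W ⊆ im(f)` such that every map which
is a homomorphism on `im(f)` and on `Y ∪ W` is a homomorphism on
`im(f) ∪ Y`. -/
def IsFo (ar : ι → ℕ) (rel : ∀ i, (Fin (ar i) → A) → Prop) (f : A → A) : Prop :=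
  IsEmb ar rel f ∧
    ∀ Y : Finset A, (↑Y : Set A) ⊆ (Set.range f)ᶜ →
      ∃ W : Finset A, (↑W : Set A) ⊆ Set.range f ∧
        ∀ t : A → A,
          IsPartialHomOn ar rel (Set.range f) t →
          IsPartialHomOn ar rel (↑Y ∪ ↑W) t →
          IsPartialHomOn ar rel (Set.range f ∪ ↑Y) t

/-- The self-embedding `f` is **back**: for every finite `T` there is a finite
`U ⊇ T` such that for every `v ∉ U` there is an automorphism `α` fixing `U`
pointwise with `α v ∉ im(f)`, and such that every finite partial map `t` with
`α '' (U ∪ {v}) ⊆ dom t ⊆ α '' (U ∪ {v}) ∪ im(f)` which is a homomorphism on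
`dom t ∖ {α v}` and on `α '' (U ∪ {v})` is a homomorphism on `dom t`. -/
def IsBack (ar : ι → ℕ) (rel : ∀ i, (Fin (ar i) → A) → Prop) (f : A → A) : Prop :=
  ∀ T : Finset A, ∃ U : Finset A, T ⊆ U ∧
    ∀ v : A, v ∉ U →
      ∃ α : A → A, IsAuto ar rel α ∧ (∀ x ∈ U, α x = x) ∧
        α v ∉ Set.range f ∧
        ∀ D : Set A, D.Finite →
          α '' (↑U ∪ {v}) ⊆ D → D ⊆ α '' (↑U ∪ {v}) ∪ Set.range f →
          ∀ t : A → A,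
            IsPartialHomOn ar rel (D \ {α v}) t →
            IsPartialHomOn ar rel (α '' (↑U ∪ {v})) t →
            IsPartialHomOn ar rel D t

/-- The topology of pointwise convergence on a set `S` of self-maps of `X`,
where `X` carries the discrete topology. -/
def pointwiseTop (X : Type*) (S : Set (X → X)) : TopologicalSpace ↥S :=
  TopologicalSpace.generateFrom
    {U : Set ↥S | ∃ x y : X, U = {f : ↥S | f.1 x = y}}

/-- Property **X** of the semigroup (of self-maps, under composition in
diagrammatic order) `S` with respect to the subset `G ⊆ S`, for the topology
`τ` on `S`. -/
def HasPropertyX {X : Type*} (S G : Set (X → X)) (τ : TopologicalSpace ↥S) : Prop :=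
  ∀ s : ↥S, ∃ f g t : ↥S, t.1 ∈ G ∧
    s.1 = g.1 ∘ t.1 ∘ f.1 ∧
    ∀ B : Set ↥S, B ∈ @nhds ↥S τ t →
      {u : ↥S | ∃ b : ↥S, b ∈ B ∧ b.1 ∈ G ∧ u.1 = g.1 ∘ b.1 ∘ f.1} ∈ @nhds ↥S τ s

section BackAndForth

variable {ar : ι → ℕ} {rel : ∀ i, (Fin (ar i) → A) → Prop} {f g s τ σ h : A → A}

theorem IsAuto.id : IsAuto ar rel (id : A → A) :=
  ⟨Function.bijective_id, fun _ _ => Iff.rfl⟩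

theorem IsAuto.comp (hσ : IsAuto ar rel σ) (hτ : IsAuto ar rel τ) : IsAuto ar rel (σ ∘ τ) :=
  ⟨hσ.1.comp hτ.1, fun i x => (hτ.2 i x).trans (hσ.2 i (τ ∘ x))⟩

theorem IsAuto.isHom (hτ : IsAuto ar rel τ) : IsHom ar rel τ :=
  fun i x => (hτ.2 i x).1

theorem IsAuto.exists_inverse (hτ : IsAuto ar rel τ) :
    ∃ σ : A → A, IsAuto ar rel σ ∧ Function.LeftInverse σ τ ∧ Function.RightInverse σ τ := by
  obtain ⟨σ, hl, hr⟩ := Function.bijective_iff_has_inverse.1 hτ.1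
  refine ⟨σ, ⟨Function.bijective_iff_has_inverse.2 ⟨τ, hr, hl⟩, fun i x => ?_⟩, hl, hr⟩
  rw [hτ.2 i (σ ∘ x), ← Function.comp_assoc, hr.comp_eq_id, Function.id_comp]

theorem IsHom.comp (hg : IsHom ar rel g) (hf : IsHom ar rel f) : IsHom ar rel (g ∘ f) :=
  fun i x hx => hg i _ (hf i x hx)

theorem IsPartialHomOn.mono {D E : Set A} (hE : IsPartialHomOn ar rel E h) (hDE : D ⊆ E) :
    IsPartialHomOn ar rel D h :=
  fun i x hx => hE i x fun k => hDE (hx k)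

theorem IsPartialHomOn.congr {D : Set A} {h' : A → A} (hD : IsPartialHomOn ar rel D h)
    (heq : EqOn h h' D) : IsPartialHomOn ar rel D h' := by
  intro i x hx hr
  have : h' ∘ x = h ∘ x := funext fun k => (heq (hx k)).symm
  exact this ▸ hD i x hx hr

theorem IsHom.isPartialHomOn (hh : IsHom ar rel h) (D : Set A) : IsPartialHomOn ar rel D h :=
  fun i x _ => hh i x

/-- A map with `h ∘ f = s` is a homomorphism on the image of the embedding `f`. -/
theorem IsPartialHomOn.range_of_comp_eq (hf : IsEmb ar rel f) (hs : IsHom ar rel s)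
    (h_comp : ∀ a, h (f a) = s a) : IsPartialHomOn ar rel (range f) h := by
  intro i x hx hr
  choose y hy using hx
  obtain rfl : f ∘ y = x := funext hy
  have : h ∘ f ∘ y = s ∘ y := funext fun k => h_comp (y k)
  exact this ▸ hs i y ((hf.2 i y).2 hr)

/-- Finite approximations `τ|_D` to an automorphism `t` with `g ∘ t ∘ f = s`: the maps
`s ∘ f⁻¹` and `g ∘ τ|_D` have a common extension that is a homomorphism on `im f ∪ D`. -/
def IsApprox (ar : ι → ℕ) (rel : ∀ i, (Fin (ar i) → A) → Prop) (f g s τ : A → A)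
    (D : Finset A) : Prop :=
  IsAuto ar rel τ ∧ ∃ h : A → A, (∀ a, h (f a) = s a) ∧ (∀ y ∈ D, h y = g (τ y)) ∧
    IsPartialHomOn ar rel (range f ∪ ↑D) h

theorem IsApprox.mono {D E : Finset A} (hE : IsApprox ar rel f g s τ E) (hDE : D ⊆ E) :
    IsApprox ar rel f g s τ D := by
  obtain ⟨hτ, h, hs, hD, hh⟩ := hE
  exact ⟨hτ, h, hs, fun y hy => hD y (hDE hy),
    hh.mono (union_subset_union_right _ (Finset.coe_subset.2 hDE))⟩

theorem IsApprox.comp_eq {D : Finset A} (hD : IsApprox ar rel f g s τ D) {a : A}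
    (ha : f a ∈ D) : g (τ (f a)) = s a := by
  obtain ⟨-, h, hs, hD, -⟩ := hD
  rw [← hD _ ha, hs]

open Classical in
/-- The property fo turns a finite amount of agreement into an approximation. -/
theorem IsApprox.of_fo {D W : Finset A} (hf : IsEmb ar rel f) (hg : IsHom ar rel g)
    (hs : IsHom ar rel s) (hτ : IsAuto ar rel τ)
    (hW : ∀ t : A → A, IsPartialHomOn ar rel (range f) t →
      IsPartialHomOn ar rel (↑(D.filter (· ∉ range f)) ∪ ↑W) t →
      IsPartialHomOn ar rel (range f ∪ ↑(D.filter (· ∉ range f))) t)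
    (heq : ∀ a, f a ∈ D ∪ W → g (τ (f a)) = s a) :
    IsApprox ar rel f g s τ D := by
  have key : ∀ a, (if hy : f a ∈ range f then s hy.choose else g (τ (f a))) = s a := by
    intro a
    have hy : f a ∈ range f := mem_range_self a
    rw [dif_pos hy, hf.1 hy.choose_spec]
  set h : A → A := fun y => if hy : y ∈ range f then s hy.choose else g (τ y) with h_def
  have h_eq : ∀ y, y ∈ D ∪ W ∨ y ∉ range f → h y = g (τ y) := by
    intro y hy
    by_cases hyf : y ∈ range f
    · obtain ⟨a, rfl⟩ := hyf
      rw [heq a (hy.resolve_right (not_not.2 (mem_range_self a)))]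
      exact key a
    · simp only [h_def, dif_neg hyf]
  refine ⟨hτ, h, key, fun y hy => h_eq y (Or.inl (Finset.mem_union_left _ hy)), ?_⟩
  refine (hW h (.range_of_comp_eq hf hs key)
    (((hg.comp hτ.isHom).isPartialHomOn _).congr ?_)).mono ?_
  · rintro y (hy | hy)
    · exact (h_eq y (Or.inr (Finset.mem_filter.1 hy).2)).symm
    · exact (h_eq y (Or.inl (Finset.mem_union_right _ hy))).symm
  · rintro y (hy | hy)
    · exact Or.inl hy
    · by_cases hyf : y ∈ range f
      · exact Or.inl hyf
      · exact Or.inr (Finset.mem_filter.2 ⟨hy, hyf⟩)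

open Classical in
theorem IsApprox.exists_insert_of_mem_range (hg : IsRth ar rel g) {D : Finset A}
    (hD : IsApprox ar rel f g s τ D) {y : A} (hy : y ∈ range f) :
    ∃ τ' : A → A, (∀ x ∈ D, τ' x = τ x) ∧ IsApprox ar rel f g s τ' (insert y D) := by
  by_cases hyD : y ∈ D
  · exact ⟨τ, fun _ _ => rfl, by rwa [Finset.insert_eq_of_mem hyD]⟩
  obtain ⟨hτ, h, hs, h_eq, hh⟩ := hD
  obtain ⟨σ, hσ, hl, hr⟩ := hτ.exists_inverse
  obtain ⟨α, hα, hfix, hv⟩ := hg.2 (D.image τ) (τ y)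
    (by simpa [hτ.1.1.eq_iff] using hyD) (h y) (by
      intro i x hx hrel
      have h_comp : (fun x => if _h : x = τ y then h y else g x) ∘ x = h ∘ σ ∘ x := by
        funext k
        by_cases hk : x k = τ y
        · simp [hk, hl y]
        · rcases hx k with hk' | hk'
          · obtain ⟨d, hd, hdx⟩ := Finset.mem_image.1 hk'
            simp only [Function.comp_apply, dif_neg hk]
            rw [← hdx, hl d, h_eq d hd]
          · exact absurd hk' hk
      rw [h_comp]
      refine hh i _ (fun k => ?_) ((hσ.2 i x).1 hrel)
      rcases hx k with hk | hk
      · obtain ⟨d, hd, hdx⟩ := Finset.mem_image.1 hk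
        right
        simpa [← hdx, hl d] using hd
      · left
        rw [mem_singleton_iff] at hk
        simpa [hk, hl y] using hy)
  have hfix' : ∀ x ∈ D, α (τ x) = τ x := fun x hx => hfix _ (Finset.mem_image_of_mem _ hx)
  refine ⟨α ∘ τ, hfix', hα.comp hτ, h, hs, fun x hx => ?_, hh.mono ?_⟩
  · rcases Finset.mem_insert.1 hx with rfl | hx
    · exact hv.symm
    · rw [h_eq x hx, Function.comp_apply, hfix' x hx]
  · rintro x (hx | hx)
    · exact Or.inl hx
    · rcases Finset.mem_insert.1 hx with rfl | hx
      · exact Or.inl hy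
      · exact Or.inr hx

open Classical in
/-- One-point extensions of the domain yield extensions by finite sets. -/
theorem IsApprox.exists_union {R : Set A}
    (step : ∀ (τ : A → A) (D : Finset A), IsApprox ar rel f g s τ D → ∀ y ∈ R,
      ∃ τ' : A → A, (∀ x ∈ D, τ' x = τ x) ∧ IsApprox ar rel f g s τ' (insert y D))
    {D : Finset A} (hD : IsApprox ar rel f g s τ D) (W : Finset A) (hW : (W : Set A) ⊆ R) :
    ∃ τ' : A → A, (∀ x ∈ D, τ' x = τ x) ∧ IsApprox ar rel f g s τ' (W ∪ D) := by
  induction W using Finset.induction_on with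
  | empty => exact ⟨τ, fun _ _ => rfl, by simpa using hD⟩
  | insert y W _ ih =>
    obtain ⟨τ₁, h₁, hτ₁⟩ := ih fun x hx => hW (Finset.mem_insert_of_mem hx)
    obtain ⟨τ₂, h₂, hτ₂⟩ := step τ₁ _ hτ₁ y (hW (Finset.mem_insert_self y W))
    refine ⟨τ₂, fun x hx => ?_, by rwa [Finset.insert_union]⟩
    rw [h₂ x (Finset.mem_union_right _ hx), h₁ x hx]

open Classical in
theorem IsApprox.exists_insert (hgh : IsHom ar rel g) (hf : IsFo ar rel f) (hg : IsRth ar rel g)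
    (hs : IsHom ar rel s) {D : Finset A} (hD : IsApprox ar rel f g s τ D) (y : A) :
    ∃ τ' : A → A, (∀ x ∈ D, τ' x = τ x) ∧ IsApprox ar rel f g s τ' (insert y D) := by
  by_cases hy : y ∈ range f
  · exact hD.exists_insert_of_mem_range hg hy
  obtain ⟨W, hWf, hW⟩ := hf.2 ((insert y D).filter (· ∉ range f))
    fun x hx => (Finset.mem_filter.1 hx).2
  obtain ⟨τ', h_eq, hτ'⟩ := IsApprox.exists_union
    (fun _ _ h _ => h.exists_insert_of_mem_range hg) hD W hWf
  refine ⟨τ', h_eq, .of_fo hf.1 hgh hs hτ'.1 hW fun a ha => hτ'.comp_eq ?_⟩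
  have : f a ≠ y := fun h => hy ⟨a, h⟩
  simp only [Finset.mem_union, Finset.mem_insert, this, false_or] at ha ⊢
  exact ha.symm

open Classical in
theorem IsApprox.exists_mem_image (hgh : IsHom ar rel g) (hb : IsBack ar rel f)
    (hf : IsFo ar rel f) (hg : IsRth ar rel g) (hs : IsHom ar rel s) {D : Finset A}
    (hD : IsApprox ar rel f g s τ D) (z : A) :
    ∃ (τ' : A → A) (E : Finset A), D ⊆ E ∧ (∀ x ∈ D, τ' x = τ x) ∧
      IsApprox ar rel f g s τ' E ∧ ∃ e ∈ E, τ' e = z := by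
  obtain ⟨U, hDU, hU⟩ := hb D
  obtain ⟨τ₁, h₁, hτ₁⟩ := IsApprox.exists_union (R := univ)
    (fun _ _ h y _ => h.exists_insert hgh hf hg hs y) hD U (subset_univ _)
  obtain ⟨hτ, h, h_comp, h_eq, hh⟩ := hτ₁.mono Finset.subset_union_left
  obtain ⟨v, rfl⟩ := hτ.1.2 z
  by_cases hv : v ∈ U
  · exact ⟨τ₁, U, hDU, h₁, ⟨hτ, h, h_comp, h_eq, hh⟩, v, hv, rfl⟩
  obtain ⟨α, hα, hfix, hαv, hback⟩ := hU v hv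
  obtain ⟨β, hβ, hl, hr⟩ := hα.exists_inverse
  have hβU : ∀ x ∈ U, β x = x := fun x hx => by
    have := hl x
    rwa [hfix x hx] at this
  have himage : α '' (↑U ∪ {v}) = ↑(insert (α v) U) := by
    rw [image_union, image_singleton, Finset.coe_insert, union_singleton]
    congr 1
    exact (image_congr fun x hx => hfix x hx).trans (image_id' _)
  rw [himage] at hback
  set h' : A → A := Function.update h (α v) (g (τ₁ v)) with h'_def
  have hne : ∀ x, x ≠ α v → h' x = h x := fun x hx => Function.update_of_ne hx _ _
  have hαvU : α v ∉ U := fun hmem => by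
    have := hα.1.1 (hfix _ hmem)
    exact hv (this ▸ hmem)
  have h'_eq : ∀ y ∈ insert (α v) U, h' y = g (τ₁ (β y)) := by
    intro y hy
    rcases Finset.mem_insert.1 hy with rfl | hy
    · rw [hl v, h'_def, Function.update_self]
    · rw [hne y (fun e => hαvU (e ▸ hy)), h_eq y hy, hβU y hy]
  refine ⟨τ₁ ∘ β, insert (α v) U, hDU.trans (Finset.subset_insert _ _), fun x hx => ?_,
    ⟨hτ.comp hβ, h', fun a => ?_, h'_eq, ?_⟩, α v, Finset.mem_insert_self _ _,
    congrArg τ₁ (hl v)⟩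
  · rw [Function.comp_apply, hβU x (hDU hx), h₁ x hx]
  · rw [hne _ fun e => hαv ⟨a, e⟩, h_comp]
  · intro i x hx
    refine hback (↑(insert (α v) U) ∪ range x)
      ((Finset.finite_toSet _).union (finite_range x)) subset_union_left ?_ h' ?_ ?_ i x
      fun k => Or.inr (mem_range_self k)
    · rintro y (hy | ⟨k, rfl⟩)
      · exact Or.inl hy
      · exact (hx k).symm
    · refine IsPartialHomOn.congr (h := h) (hh.mono ?_) fun y hy => (hne y hy.2).symm
      rintro y ⟨hy | ⟨k, rfl⟩, hne⟩
      · exact Or.inr ((Finset.mem_insert.1 hy).resolve_left hne)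
      · exact (hx k).imp_right fun hk => (Finset.mem_insert.1 hk).resolve_left hne
    · exact (((hgh.comp hτ.isHom).comp hβ.isHom).isPartialHomOn _).congr
        fun y hy => (h'_eq y hy).symm

/-- A coherent sequence of automorphisms on an exhausting sequence of finite sets converges to
an automorphism. -/
theorem exists_isAuto_of_coherent {τ : ℕ → A → A} {D : ℕ → Finset A}
    (hτ : ∀ n, IsAuto ar rel (τ n)) (hD : Monotone D)
    (h_eq : ∀ n, ∀ x ∈ D n, τ (n + 1) x = τ n x) (h_dom : ∀ a, ∃ n, a ∈ D n)
    (h_im : ∀ a, ∃ n, ∃ x ∈ D n, τ n x = a) :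
    ∃ t : A → A, IsAuto ar rel t ∧ ∀ n, ∀ x ∈ D n, t x = τ n x := by
  have h_le : ∀ m n, m ≤ n → ∀ x ∈ D m, τ n x = τ m x := by
    intro m n hmn
    induction n, hmn using Nat.le_induction with
    | base => exact fun _ _ => rfl
    | succ n hmn ih => exact fun x hx => (h_eq n x (hD hmn hx)).trans (ih x hx)
  choose N hN using h_dom
  have ht : ∀ n, ∀ x ∈ D n, τ (N x) x = τ n x := by
    intro n x hx
    rcases le_total (N x) n with hn | hn
    · exact (h_le _ _ hn x (hN x)).symm
    · exact h_le _ _ hn x hx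
  refine ⟨fun x => τ (N x) x, ⟨⟨fun x y hxy => ?_, fun a => ?_⟩, fun i x => ?_⟩, ht⟩
  · refine (hτ (max (N x) (N y))).1.1 ?_
    rw [h_le _ _ (le_max_left _ _) x (hN x), h_le _ _ (le_max_right _ _) y (hN y)]
    exact hxy
  · obtain ⟨n, x, hx, rfl⟩ := h_im a
    exact ⟨x, ht n x hx⟩
  · obtain ⟨n, hn⟩ := (finite_range (N ∘ x)).bddAbove
    have : (fun a => τ (N a) a) ∘ x = τ n ∘ x :=
      funext fun k => ht n _ (hD (hn (mem_range_self k)) (hN (x k)))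
    rw [this]
    exact (hτ n).2 i x

theorem IsApprox.exists_isAuto [Countable A] (hgh : IsHom ar rel g) (hb : IsBack ar rel f)
    (hf : IsFo ar rel f) (hg : IsRth ar rel g) (hs : IsHom ar rel s) {D : Finset A}
    (hD : IsApprox ar rel f g s τ D) :
    ∃ t : A → A, IsAuto ar rel t ∧ (∀ x ∈ D, t x = τ x) ∧ g ∘ t ∘ f = s := by
  classical
  rcases isEmpty_or_nonempty A with hA | hA
  · exact ⟨τ, hD.1, fun _ _ => rfl, Subsingleton.elim _ _⟩
  obtain ⟨e, he⟩ := exists_surjective_nat A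
  have step : ∀ (p : {p : (A → A) × Finset A // IsApprox ar rel f g s p.1 p.2}) (a : A),
      ∃ q : {q : (A → A) × Finset A // IsApprox ar rel f g s q.1 q.2},
        p.1.2 ⊆ q.1.2 ∧ (∀ x ∈ p.1.2, q.1.1 x = p.1.1 x) ∧ a ∈ q.1.2 ∧
          ∃ x ∈ q.1.2, q.1.1 x = a := by
    rintro ⟨⟨τ₀, D₀⟩, hp⟩ a
    obtain ⟨τ₁, h₁, hτ₁⟩ := hp.exists_insert hgh hf hg hs a
    obtain ⟨τ₂, E, hE, h₂, hτ₂, hmem⟩ := hτ₁.exists_mem_image hgh hb hf hg hs a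
    refine ⟨⟨(τ₂, E), hτ₂⟩, (Finset.subset_insert _ _).trans hE, fun x hx => ?_,
      hE (Finset.mem_insert_self _ _), hmem⟩
    exact (h₂ x (Finset.mem_insert_of_mem hx)).trans (h₁ x hx)
  choose next h_sub h_eq h_dom h_im using step
  let p : ℕ → {p : (A → A) × Finset A // IsApprox ar rel f g s p.1 p.2} :=
    fun n => Nat.rec ⟨(τ, D), hD⟩ (fun n q => next q (e n)) n
  obtain ⟨t, ht, ht_eq⟩ := exists_isAuto_of_coherent (τ := fun n => (p n).1.1)
    (D := fun n => (p n).1.2) (fun n => (p n).2.1)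
    (monotone_nat_of_le_succ fun n => h_sub (p n) (e n)) (fun n => h_eq (p n) (e n))
    (fun a => (he a).elim fun n hn => ⟨n + 1, hn ▸ h_dom (p n) (e n)⟩)
    (fun a => (he a).elim fun n hn => ⟨n + 1, hn ▸ h_im (p n) (e n)⟩)
  refine ⟨t, ht, ht_eq 0, funext fun a => ?_⟩
  obtain ⟨n, hn⟩ := he (f a)
  have hmem : f a ∈ (p (n + 1)).1.2 := hn ▸ h_dom (p n) (e n)
  exact (congrArg g (ht_eq (n + 1) _ hmem)).trans ((p (n + 1)).2.comp_eq hmem)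

end BackAndForth

theorem mem_nhds_pointwiseTop {X : Type*} {S : Set (X → X)} {t : ↥S} {B : Set ↥S} :
    B ∈ @nhds ↥S (pointwiseTop X S) t ↔
      ∃ F : Finset X, ∀ b : ↥S, (∀ x ∈ F, b.1 x = t.1 x) → b ∈ B := by
  classical
  let _ : TopologicalSpace ↥S := pointwiseTop X S
  constructor
  · intro hB
    obtain ⟨U, hUB, hU, htU⟩ := mem_nhds_iff.1 hB
    suffices ∃ F : Finset X, ∀ b : ↥S, (∀ x ∈ F, b.1 x = t.1 x) → b ∈ U from
      this.imp fun F hF b hb => hUB (hF b hb)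
    clear hUB hB
    induction hU with
    | basic U hU =>
      obtain ⟨x, y, rfl⟩ := hU
      exact ⟨{x}, fun b hb => (hb x (Finset.mem_singleton_self x)).trans htU⟩
    | univ => exact ⟨∅, fun _ _ => trivial⟩
    | inter U V _ _ ihU ihV =>
      obtain ⟨F, hF⟩ := ihU htU.1
      obtain ⟨G, hG⟩ := ihV htU.2
      exact ⟨F ∪ G, fun b hb => ⟨hF b fun x hx => hb x (Finset.mem_union_left _ hx),
        hG b fun x hx => hb x (Finset.mem_union_right _ hx)⟩⟩
    | sUnion C _ ih =>
      obtain ⟨U, hUC, htU⟩ := htU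
      exact (ih U hUC htU).imp fun F hF b hb => ⟨U, hUC, hF b hb⟩
  · rintro ⟨F, hF⟩
    refine Filter.mem_of_superset ((Filter.biInter_finset_mem F).2 fun x _ =>
      IsOpen.mem_nhds (s := {b : ↥S | b.1 x = t.1 x})
        (TopologicalSpace.isOpen_generateFrom_of_mem ⟨x, t.1 x, rfl⟩) rfl) ?_
    exact fun b hb => hF b fun x hx => mem_iInter₂.1 hb x hx


theorem end_has_propertyX_of_back_fo_rth
    [Countable A]
    (ar : ι → ℕ) (rel : ∀ i, (Fin (ar i) → A) → Prop)
    (homog : Homogeneous ar rel)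
    (f g : A → A) (hf : IsHom ar rel f) (hg : IsHom ar rel g)
    (hback : IsBack ar rel f) (hfo : IsFo ar rel f) (hrth : IsRth ar rel g) :
    HasPropertyX (endSet ar rel) (autSet ar rel) (pointwiseTop A (endSet ar rel)) := by
  classical
  rintro ⟨s, hs⟩
  have h_init : IsApprox ar rel f g s id ∅ := by
    refine ⟨IsAuto.id, Function.extend f s id, fun a => hfo.1.1.extend_apply s id a, by simp, ?_⟩
    rw [Finset.coe_empty, union_empty]
    exact .range_of_comp_eq hfo.1 hs fun a => hfo.1.1.extend_apply s id a
  obtain ⟨t, ht, -, hts⟩ := h_init.exists_isAuto hg hback hfo hrth hs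
  refine ⟨⟨f, hf⟩, ⟨g, hg⟩, ⟨t, ht.isHom⟩, ht, hts.symm, fun B hB => ?_⟩
  obtain ⟨F, hF⟩ := mem_nhds_pointwiseTop.1 hB
  obtain ⟨W, -, hW⟩ := hfo.2 (F.filter (· ∉ range f)) fun x hx => (Finset.mem_filter.1 hx).2
  refine mem_nhds_pointwiseTop.2 ⟨(F ∪ W).preimage f hfo.1.1.injOn, ?_⟩
  rintro ⟨u, hu⟩ hus
  have hF_approx : IsApprox ar rel f g u t F := .of_fo hfo.1 hg hu ht hW fun a ha =>
    (congrFun hts a).trans (hus a (Finset.mem_preimage.2 ha)).symm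
  obtain ⟨b, hb, hbt, hbu⟩ := hF_approx.exists_isAuto hg hback hfo hrth hu
  exact ⟨⟨b, hb.isHom⟩, hF ⟨b, hb.isHom⟩ hbt, hb, hbu.symm⟩
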